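/- arXiv:2411.14142 — 2 statements merged into one kernel-verified Lean document; each statement's English description precedes it below -/
import Mathlib

section
/- Let R be a commutative ring and S a multiplicative subset of R. If 0 → M₁ → M₂ → C → 0 is an s-pure short exact sequence of R-modules and M₂ is s-absolutely pure, then M₁ is s-absolutely pure; that is, any s-pure submodule of an s-absolutely pure module is s-absolutely pure. -/
open CategoryTheory TensorProduct

universe u

variable {R : Type u} [CommRing R]

/-- `Tor₁^R(M, N)` as an object of `ModuleCat R`, via the derived tensor product. -/
noncomputable abbrev Tor1 (R : Type u) [CommRing R] (M N : Type u)
    [AddCommGroup M] [Module R M] [AddCommGroup N] [Module R N] : ModuleCat.{u} R :=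
  ((Tor (ModuleCat.{u} R) 1).obj (ModuleCat.of R M)).obj (ModuleCat.of R N)

/-- `Ext¹_R(M, N)` as an object of `ModuleCat R`. -/
noncomputable abbrev Ext1 (R : Type u) [CommRing R] (M N : Type u)
    [AddCommGroup M] [Module R M] [AddCommGroup N] [Module R N] : ModuleCat.{u} R :=
  ((Ext R (ModuleCat.{u} R) 1).obj (Opposite.op (ModuleCat.of R M))).obj (ModuleCat.of R N)

/-- u-S-exactness at the middle spot of `A →f B →g C`, with respect to a given `s`:
`s • ker g ⊆ im f` and `s • im f ⊆ ker g`. -/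
def IsUSExactAtWith (s : R) {A B C : Type u} [AddCommGroup A] [Module R A]
    [AddCommGroup B] [Module R B] [AddCommGroup C] [Module R C]
    (f : A →ₗ[R] B) (g : B →ₗ[R] C) : Prop :=
  (∀ x ∈ LinearMap.ker g, s • x ∈ LinearMap.range f) ∧
  (∀ x ∈ LinearMap.range f, s • x ∈ LinearMap.ker g)

/-- The sequence `0 → A →f B →g C → 0` is u-S-exact with respect to the single element `s`. -/
def ShortUSExactWith (s : R) {A B C : Type u} [AddCommGroup A] [Module R A]
    [AddCommGroup B] [Module R B] [AddCommGroup C] [Module R C]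
    (f : A →ₗ[R] B) (g : B →ₗ[R] C) : Prop :=
  (∀ x ∈ LinearMap.ker f, s • x = (0 : A)) ∧ IsUSExactAtWith s f g ∧
    (∀ c : C, s • c ∈ LinearMap.range g)

/-- The sequence `0 → A →f B →g C → 0` is u-S-exact (at every place, with possibly
different witnesses `s ∈ S`). -/
def ShortUSExact (S : Submonoid R) {A B C : Type u} [AddCommGroup A] [Module R A]
    [AddCommGroup B] [Module R B] [AddCommGroup C] [Module R C]
    (f : A →ₗ[R] B) (g : B →ₗ[R] C) : Prop :=
  (∃ s ∈ S, ∀ x ∈ LinearMap.ker f, s • x = (0 : A)) ∧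
  (∃ s ∈ S, IsUSExactAtWith s f g) ∧
  (∃ s ∈ S, ∀ c : C, s • c ∈ LinearMap.range g)

/-- A short exact sequence `0 → A →f B →g C → 0` is s-pure if tensoring it with every
finitely presented module yields a u-S-exact sequence. -/
def SPure (S : Submonoid R) {A B C : Type u} [AddCommGroup A] [Module R A]
    [AddCommGroup B] [Module R B] [AddCommGroup C] [Module R C]
    (f : A →ₗ[R] B) (g : B →ₗ[R] C) : Prop :=
  ∀ (M : Type u) [AddCommGroup M] [Module R M], Module.FinitePresentation R M →
    ShortUSExact S (LinearMap.lTensor M f) (LinearMap.lTensor M g)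

/-- A short exact sequence `0 → A →f B →g C → 0` is pure if tensoring it with every
finitely presented module yields an exact sequence `0 → M⊗A → M⊗B → M⊗C → 0`. -/
def IsPureSES {A B C : Type u} [AddCommGroup A] [Module R A]
    [AddCommGroup B] [Module R B] [AddCommGroup C] [Module R C]
    (f : A →ₗ[R] B) (g : B →ₗ[R] C) : Prop :=
  ∀ (M : Type u) [AddCommGroup M] [Module R M], Module.FinitePresentation R M →
    Function.Injective (LinearMap.lTensor M f) ∧
    Function.Exact (LinearMap.lTensor M f) (LinearMap.lTensor M g) ∧
    Function.Surjective (LinearMap.lTensor M g)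

/-- An `R`-module `F` is s-flat if for every finitely presented `M` there is `s ∈ S`
with `s • Tor₁(M, F) = 0`. -/
def IsSFlat (S : Submonoid R) (F : Type u) [AddCommGroup F] [Module R F] : Prop :=
  ∀ (M : Type u) [AddCommGroup M] [Module R M], Module.FinitePresentation R M →
    ∃ s ∈ S, ∀ x : Tor1 R M F, s • x = 0

/-- An `R`-module `E` is s-absolutely pure if for every finitely presented `N` there is
`s ∈ S` with `s • Ext¹(N, E) = 0`. -/
def IsSAbsolutelyPure (S : Submonoid R) (E : Type u) [AddCommGroup E] [Module R E] : Prop :=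
  ∀ (N : Type u) [AddCommGroup N] [Module R N], Module.FinitePresentation R N →
    ∃ s ∈ S, ∀ x : Ext1 R N E, s • x = 0

/-- An `R`-module `E` is absolutely pure if `Ext¹(N, E) = 0` for every finitely
presented `N`. -/
def IsAbsolutelyPure (R : Type u) [CommRing R] (E : Type u)
    [AddCommGroup E] [Module R E] : Prop :=
  ∀ (N : Type u) [AddCommGroup N] [Module R N], Module.FinitePresentation R N →
    ∀ x : Ext1 R N E, x = 0

/-- An injective cogenerator in the category of `R`-modules: an injective module `E`
such that `Hom_R(M, E) = 0` implies `M = 0`. -/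
def IsInjectiveCogenerator (R : Type u) [CommRing R] (E : Type u)
    [AddCommGroup E] [Module R E] : Prop :=
  Module.Injective R E ∧
    ∀ (M : Type u) [AddCommGroup M] [Module R M], (∀ φ : M →ₗ[R] E, φ = 0) → Subsingleton M

/-- An `R`-module `M` is `S`-finite if `s • M ⊆ K` for some `s ∈ S` and some finitely
generated submodule `K` of `M`. -/
def IsSFinite (S : Submonoid R) (M : Type u) [AddCommGroup M] [Module R M] : Prop :=
  ∃ s ∈ S, ∃ K : Submodule R M, K.FG ∧ ∀ m : M, s • m ∈ K

/-- An `R`-module `M` is `S`-finitely presented if there is an exact sequence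
`0 → K → F → M → 0` with `F` finitely generated free and `K` `S`-finite. -/
def IsSFinitelyPresented (S : Submonoid R) (M : Type u) [AddCommGroup M] [Module R M] : Prop :=
  ∃ (n : ℕ) (π : (Fin n → R) →ₗ[R] M), Function.Surjective π ∧
    IsSFinite S ↥(LinearMap.ker π)

/-- `R` is an `S`-coherent ring if every finitely generated ideal of `R` is
`S`-finitely presented. -/
def IsSCoherentRing (S : Submonoid R) : Prop :=
  ∀ I : Ideal R, I.FG → IsSFinitelyPresented S ↥I

/-- `s`-multiples of linear maps `K → E` on the submodule `K ≤ P` extend to `P`. -/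
def SMulExtends {R : Type*} [CommRing R] {P : Type*} [AddCommGroup P] [Module R P]
    (s : R) (K : Submodule R P) (E : Type*) [AddCommGroup E] [Module R E] : Prop :=
  ∀ φ : K →ₗ[R] E, ∃ ψ : P →ₗ[R] E, ∀ k : K, ψ k = s • φ k

/-- The extension property for the kernel of a projective presentation does not depend on
the presentation. -/
theorem SMulExtends.of_presentation {R : Type*} [CommRing R] {P P' N E : Type*}
    [AddCommGroup P] [Module R P] [AddCommGroup P'] [Module R P'] [AddCommGroup N] [Module R N]
    [AddCommGroup E] [Module R E] [Module.Projective R P] [Module.Projective R P']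
    {π : P →ₗ[R] N} {π' : P' →ₗ[R] N} (hπ : Function.Surjective π)
    (hπ' : Function.Surjective π') {s : R} (h : SMulExtends s (LinearMap.ker π') E) :
    SMulExtends s (LinearMap.ker π) E := by
  intro φ
  obtain ⟨u, hu⟩ := Module.projective_lifting_property π' π hπ'
  obtain ⟨v, hv⟩ := Module.projective_lifting_property π π' hπ
  have hu' (x : P) : π' (u x) = π x := LinearMap.congr_fun hu x
  have hv' (x : P') : π (v x) = π' x := LinearMap.congr_fun hv x
  let w : LinearMap.ker π' →ₗ[R] LinearMap.ker π :=
    v.restrict fun x hx ↦ by simpa [hv'] using hx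
  let d : P →ₗ[R] LinearMap.ker π :=
    (v ∘ₗ u - LinearMap.id).codRestrict _ fun x ↦ by simp [hu', hv']
  obtain ⟨χ, hχ⟩ := h (φ ∘ₗ w)
  refine ⟨χ ∘ₗ u - s • (φ ∘ₗ d), fun k ↦ ?_⟩
  have huk : u k ∈ LinearMap.ker π' := by simp [hu']
  have hwd : w ⟨u k, huk⟩ - d k = k := by
    ext
    simp [w, d]
  have hk : χ (u k) = s • φ (w ⟨u k, huk⟩) := hχ ⟨u k, huk⟩
  simp [hk, ← smul_sub, ← map_sub, hwd]

theorem LinearEquiv.forall_smul_eq_zero_iff {R M N : Type*} [CommRing R] [AddCommGroup M]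
    [Module R M] [AddCommGroup N] [Module R N] (e : M ≃ₗ[R] N) (s : R) :
    (∀ x : M, s • x = 0) ↔ ∀ x : N, s • x = 0 := by
  simp only [e.surjective.forall, ← map_smul, e.map_eq_zero_iff]

theorem CategoryTheory.ShortComplex.smul_homology_eq_zero_iff {R : Type u} [CommRing R]
    (T : ShortComplex (ModuleCat.{u} R)) (s : R) :
    (∀ x : T.homology, s • x = 0) ↔ ∀ y : T.X₂, T.g y = 0 → ∃ z : T.X₁, T.f z = s • y := by
  let e : T.homology ≃ₗ[R] LinearMap.ker T.g.hom ⧸ LinearMap.range T.moduleCatToCycles :=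
    T.moduleCatHomologyIso.toLinearEquiv
  rw [e.forall_smul_eq_zero_iff, (Submodule.mkQ_surjective _).forall]
  constructor
  · intro h y hy
    obtain ⟨z, hz⟩ := (Submodule.Quotient.mk_eq_zero _).1 (h ⟨y, hy⟩)
    exact ⟨z, congr_arg Subtype.val hz⟩
  · rintro h ⟨y, hy⟩
    obtain ⟨z, hz⟩ := h y hy
    exact (Submodule.Quotient.mk_eq_zero _).2 ⟨z, Subtype.ext hz⟩

theorem smul_homology_linearYonedaObj_eq_zero_iff {R : Type u} [CommRing R]
    (X : ChainComplex (ModuleCat.{u} R) ℕ) (E : ModuleCat.{u} R) (s : R) :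
    (∀ x : (X.linearYonedaObj R E).homology 1, s • x = 0) ↔
      ∀ y : X.X 1 ⟶ E, X.d 2 1 ≫ y = 0 → ∃ z : X.X 0 ⟶ E, X.d 1 0 ≫ z = s • y :=
  (((X.linearYonedaObj R E).homologyIsoSc' 0 1 2 (by simp)
    (by simp)).toLinearEquiv.forall_smul_eq_zero_iff s).trans
      (ShortComplex.smul_homology_eq_zero_iff ((X.linearYonedaObj R E).sc' 0 1 2) s)

/-- `s • Ext¹(N, E) = 0` can be tested on a projective presentation of `N`. -/
theorem smul_Ext1_eq_zero_iff {R : Type u} [CommRing R] {P N E : Type u}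
    [AddCommGroup P] [Module R P] [AddCommGroup N] [Module R N] [AddCommGroup E] [Module R E]
    [Module.Projective R P] {π : P →ₗ[R] N} (hπ : Function.Surjective π) (s : R) :
    (∀ x : Ext1 R N E, s • x = 0) ↔ SMulExtends s (LinearMap.ker π) E := by
  let Q := projectiveResolution (ModuleCat.of R N)
  let ε : Q.complex.X 0 ⟶ ModuleCat.of R N := Q.π.f 0
  have hε : Function.Surjective ε.hom :=
    (ModuleCat.epi_iff_surjective (Q.π.f 0)).1 inferInstance
  have : Module.Projective R (Q.complex.X 0) :=
    (IsProjective.iff_projective (R := R) (Q.complex.X 0)).2 (Q.projective 0)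
  have hker : LinearMap.range (Q.complex.d 1 0).hom = LinearMap.ker ε.hom :=
    Q.exact₀.moduleCat_range_eq_ker
  have hker' : LinearMap.range (Q.complex.d 2 1).hom = LinearMap.ker (Q.complex.d 1 0).hom :=
    (Q.exact_succ 0).moduleCat_range_eq_ker
  have hP : SMulExtends s (LinearMap.ker π) E ↔ SMulExtends s (LinearMap.ker ε.hom) E :=
    ⟨.of_presentation hε hπ, .of_presentation hπ hε⟩
  rw [(Q.isoExt (R := R) 1 (ModuleCat.of R E)).toLinearEquiv.forall_smul_eq_zero_iff,
    smul_homology_linearYonedaObj_eq_zero_iff, hP, ← hker]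
  constructor
  · intro h φ
    obtain ⟨z, hz⟩ := h (ModuleCat.ofHom (φ ∘ₗ (Q.complex.d 1 0).hom.rangeRestrict)) <| by
      ext x
      have hx : (Q.complex.d 1 0).hom.rangeRestrict ((Q.complex.d 2 1).hom x) = 0 :=
        Subtype.ext (hker'.le ⟨x, rfl⟩)
      simp [hx]
    refine ⟨z.hom, ?_⟩
    rintro ⟨_, x, rfl⟩
    exact LinearMap.congr_fun (congr_arg ModuleCat.Hom.hom hz) x
  · intro h y hy
    have hle : LinearMap.ker (Q.complex.d 1 0).hom ≤ LinearMap.ker y.hom := by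
      rw [← hker', LinearMap.range_le_ker_iff]
      exact congr_arg ModuleCat.Hom.hom hy
    obtain ⟨ψ, hψ⟩ := h ((LinearMap.ker (Q.complex.d 1 0).hom).liftQ y.hom hle ∘ₗ
      (Q.complex.d 1 0).hom.quotKerEquivRange.symm.toLinearMap)
    refine ⟨ModuleCat.ofHom ψ, ?_⟩
    ext x
    have hx := hψ ⟨(Q.complex.d 1 0).hom x, x, rfl⟩
    have hx' : (Q.complex.d 1 0).hom.quotKerEquivRange.symm
        ⟨(Q.complex.d 1 0).hom x, x, rfl⟩ = Submodule.Quotient.mk x :=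
      (LinearEquiv.symm_apply_eq _).2 rfl
    simpa [hx'] using hx

/-- If `s` kills the kernel of `M ⊗ f` for `M` the cokernel of a matrix `A`, then `s` times a
family `y` lies in the image of `A` as soon as its image under `f` does. -/
theorem exists_sum_smul_eq_of_lTensor {R : Type*} [CommRing R] {E F : Type*}
    [AddCommGroup E] [Module R E] [AddCommGroup F] [Module R F] (f : E →ₗ[R] F)
    {m n : Type*} [Fintype m] [Fintype n] [DecidableEq m] [DecidableEq n] (A : Matrix m n R) {s : R}
    (hs : ∀ x ∈ LinearMap.ker
      (LinearMap.lTensor ((m → R) ⧸ LinearMap.range A.mulVecLin) f), s • x = 0)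
    (y : m → E) (z : n → F) (hyz : ∀ j, f (y j) = ∑ i, A j i • z i) :
    ∃ x : n → E, ∀ j, s • y j = ∑ i, A j i • x i := by
  let q := (LinearMap.range A.mulVecLin).mkQ
  let t : (m → R) ⊗[R] E := ∑ j, Pi.single j 1 ⊗ₜ y j
  have hcol (i : n) : q (∑ j, A j i • Pi.single j 1) = 0 := by
    refine (Submodule.Quotient.mk_eq_zero _).2 ⟨Pi.single i 1, ?_⟩
    ext j
    simp [Finset.sum_apply, Pi.single_apply]
  have ht : LinearMap.rTensor E q (s • t) = 0 := by
    rw [map_smul]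
    apply hs
    rw [LinearMap.mem_ker]
    calc _ = ∑ j, ∑ i, q (A j i • Pi.single j 1) ⊗ₜ[R] z i := by
          simp [t, q, hyz, tmul_sum, smul_tmul]
      _ = ∑ i, q (∑ j, A j i • Pi.single j 1) ⊗ₜ[R] z i := by
          rw [Finset.sum_comm]
          simp only [map_sum, sum_tmul]
      _ = 0 := by simp only [hcol, zero_tmul, Finset.sum_const_zero]
  obtain ⟨w, hw⟩ := (rTensor_exact E (LinearMap.exact_map_mkQ_range A.mulVecLin)
    (Submodule.mkQ_surjective _) _).1 ht
  let p (j : m) : (m → R) ⊗[R] E →ₗ[R] E :=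
    (TensorProduct.lid R E).toLinearMap ∘ₗ LinearMap.rTensor E (LinearMap.proj j)
  have hp (w : (n → R) ⊗[R] E) :
      ∃ x : n → E, ∀ j, p j (LinearMap.rTensor E A.mulVecLin w) = ∑ i, A j i • x i := by
    induction w with
    | zero => exact ⟨0, by simp⟩
    | tmul c e =>
      refine ⟨fun i ↦ c i • e, fun j ↦ ?_⟩
      simp [p, Matrix.mulVec, dotProduct, Finset.sum_smul, mul_smul]
    | add a b ha hb =>
      obtain ⟨x, hx⟩ := ha
      obtain ⟨x', hx'⟩ := hb
      exact ⟨x + x', fun j ↦ by simp [hx, hx', Finset.sum_add_distrib]⟩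
  obtain ⟨x, hx⟩ := hp w
  refine ⟨x, fun j ↦ ?_⟩
  rw [← hx j, hw]
  simp [p, t, Pi.single_apply]

/-- Proposition 3.5: any s-pure submodule of an s-absolutely pure module is
s-absolutely pure. -/
theorem isSAbsolutelyPure_of_sPure_submodule (R : Type u) [CommRing R] (S : Submonoid R)
    (M₁ M₂ C : Type u) [AddCommGroup M₁] [Module R M₁] [AddCommGroup M₂] [Module R M₂]
    [AddCommGroup C] [Module R C] (f : M₁ →ₗ[R] M₂) (g : M₂ →ₗ[R] C)
    (hf : Function.Injective f) (hfg : LinearMap.range f = LinearMap.ker g)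
    (hg : Function.Surjective g) (hpure : SPure S f g)
    (hM₂ : IsSAbsolutelyPure S M₂) :
    IsSAbsolutelyPure S M₁ := by
  intro N _ _ hN
  obtain ⟨n, m, π, k, hπ, hk⟩ := Module.FinitePresentation.exists_fin' R N
  obtain ⟨s₁, hs₁, h₁⟩ := hM₂ N hN
  let A : Matrix (Fin m) (Fin n) R := .of fun j ↦ k (Pi.single j 1)
  obtain ⟨⟨s₂, hs₂, h₂⟩, -⟩ := hpure ((Fin m → R) ⧸ LinearMap.range A.mulVecLin)
    (Module.finitePresentation_of_surjective _ (Submodule.mkQ_surjective _) (by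
      rw [Submodule.ker_mkQ]
      exact Submodule.FG.of_finite))
  refine ⟨s₂ * s₁, mul_mem hs₂ hs₁, ?_⟩
  rw [smul_Ext1_eq_zero_iff hπ] at h₁ ⊢
  intro φ
  obtain ⟨ψ, hψ⟩ := h₁ (f ∘ₗ φ)
  let k' : (Fin m → R) →ₗ[R] LinearMap.ker π := k.codRestrict _ fun c ↦ hk.apply_apply_eq_zero c
  have hlin {F : Type u} [AddCommGroup F] [Module R F] (χ : (Fin n → R) →ₗ[R] F) (j : Fin m) :
      χ (k (Pi.single j 1)) = ∑ i, A j i • χ (Pi.single i 1) := by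
    rw [χ.pi_apply_eq_sum_univ]
    refine Finset.sum_congr rfl fun i _ ↦ congr_arg (A j i • χ ·) ?_
    ext l
    simp [Pi.single_apply, eq_comm]
  obtain ⟨x, hx⟩ := exists_sum_smul_eq_of_lTensor f A h₂
    (fun j ↦ s₁ • φ (k' (Pi.single j 1))) (fun i ↦ ψ (Pi.single i 1)) fun j ↦ by
      rw [map_smul, ← hlin]
      exact (hψ (k' (Pi.single j 1))).symm
  let χ := Fintype.linearCombination R x
  have hχ : χ ∘ₗ k = (s₂ * s₁) • (φ ∘ₗ k') := by
    ext j
    simp [hlin, χ, mul_smul, hx]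
  refine ⟨χ, ?_⟩
  rintro ⟨y, hy⟩
  obtain ⟨c, rfl⟩ := (hk y).1 hy
  exact LinearMap.congr_fun hχ c
end

section
/- Let R be a commutative ring and S a multiplicative subset of R. The following are equivalent: (1) R is an S-coherent ring; (2) any product of flat R-modules is s-flat; (3) any product of projective R-modules is s-flat; (4) any product of copies of R is s-flat. -/
open CategoryTheory TensorProduct

universe u

variable {R : Type u} [CommRing R]

theorem smul_eq_zero_of_mem_ker_rTensor (s : R) {K F M L P N : Type*}
    [AddCommGroup K] [Module R K] [AddCommGroup F] [Module R F] [AddCommGroup M] [Module R M]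
    [AddCommGroup L] [Module R L] [AddCommGroup P] [Module R P] [AddCommGroup N] [Module R N]
    {f : K →ₗ[R] F} {g : F →ₗ[R] M} {h : L →ₗ[R] P} {k : P →ₗ[R] N}
    (hf : Function.Injective f) (hfg : Function.Exact f g) (hg : Function.Surjective g)
    (hhk : Function.Exact h k) (hk : Function.Surjective k) [Module.Flat R P]
    (H : ∀ x : M ⊗[R] L, h.lTensor M x = 0 → s • x = 0)
    (x : K ⊗[R] N) (hx : f.rTensor N x = 0) : s • x = 0 := by
  obtain ⟨y, rfl⟩ := LinearMap.lTensor_surjective K hk x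
  have hy : k.lTensor F (f.rTensor P y) = 0 := by
    rw [← hx, ← LinearMap.comp_apply, ← LinearMap.comp_apply, LinearMap.lTensor_comp_rTensor,
      LinearMap.rTensor_comp_lTensor]
  obtain ⟨w, hw⟩ := (lTensor_exact F hhk hk _).1 hy
  have hw0 : h.lTensor M (g.rTensor L w) = 0 := by
    rw [← LinearMap.comp_apply, LinearMap.lTensor_comp_rTensor, ← LinearMap.rTensor_comp_lTensor,
      LinearMap.comp_apply, hw]
    exact (rTensor_exact P hfg hg).apply_apply_eq_zero y
  have hsw : g.rTensor L (s • w) = 0 := by rw [map_smul, H _ hw0]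
  obtain ⟨v, hv⟩ := (rTensor_exact L hfg hg _).1 hsw
  have hvy : h.lTensor K v = s • y := by
    apply Module.Flat.rTensor_preserves_injective_linearMap (M := P) f hf
    rw [map_smul, ← hw, ← map_smul, ← hv, ← LinearMap.comp_apply, ← LinearMap.comp_apply,
      LinearMap.lTensor_comp_rTensor, LinearMap.rTensor_comp_lTensor]
  rw [← map_smul, ← hvy]
  exact (lTensor_exact K hhk hk).apply_apply_eq_zero v

theorem smul_eq_zero_on_ker_lTensor_iff (s : R) {K F M L P N : Type*}
    [AddCommGroup K] [Module R K] [AddCommGroup F] [Module R F] [AddCommGroup M] [Module R M]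
    [AddCommGroup L] [Module R L] [AddCommGroup P] [Module R P] [AddCommGroup N] [Module R N]
    {f : K →ₗ[R] F} {g : F →ₗ[R] M} {h : L →ₗ[R] P} {k : P →ₗ[R] N}
    (hf : Function.Injective f) (hfg : Function.Exact f g) (hg : Function.Surjective g)
    (hh : Function.Injective h) (hhk : Function.Exact h k) (hk : Function.Surjective k)
    [Module.Flat R F] [Module.Flat R P] :
    (∀ x : M ⊗[R] L, h.lTensor M x = 0 → s • x = 0) ↔
      ∀ x : K ⊗[R] N, f.rTensor N x = 0 → s • x = 0 := by
  refine ⟨smul_eq_zero_of_mem_ker_rTensor s hf hfg hg hhk hk, fun H x hx ↦ ?_⟩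
  have := smul_eq_zero_of_mem_ker_rTensor s hh hhk hk hfg hg (M := N) (N := M) (fun z hz ↦ ?_)
    (TensorProduct.comm R M L x) ?_
  · apply (TensorProduct.comm R M L).injective
    rw [map_smul, this, map_zero]
  · apply (TensorProduct.comm R N K).injective
    rw [map_smul, map_zero]
    refine H _ ?_
    rw [LinearMap.rTensor, TensorProduct.map_comm]
    exact (congrArg _ hz).trans (map_zero _)
  · rw [LinearMap.rTensor, TensorProduct.map_comm]
    exact (congrArg _ hx).trans (map_zero _)

theorem forall_smul_moduleCatHomology_iff (s : R) (S : ShortComplex (ModuleCat.{u} R)) :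
    (∀ x : S.homology, s • x = 0) ↔
      ∀ z : S.X₂, S.g.hom z = 0 → s • z ∈ LinearMap.range S.f.hom := by
  have e : S.homology ≃ₗ[R] LinearMap.ker S.g.hom ⧸ LinearMap.range S.moduleCatToCycles :=
    S.moduleCatHomologyIso.toLinearEquiv
  have : (∀ x : S.homology, s • x = 0) ↔
      ∀ x : LinearMap.ker S.g.hom ⧸ LinearMap.range S.moduleCatToCycles, s • x = 0 :=
    ⟨fun H x ↦ e.symm.injective (by rw [map_smul, H, map_zero]),
      fun H x ↦ e.injective (by rw [map_smul, H, map_zero])⟩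
  rw [this]
  constructor
  · intro H z hz
    have := H (Submodule.Quotient.mk ⟨z, hz⟩)
    rw [← Submodule.Quotient.mk_smul, Submodule.Quotient.mk_eq_zero] at this
    obtain ⟨w, hw⟩ := this
    exact ⟨w, congrArg Subtype.val hw⟩
  · intro H x
    obtain ⟨z, rfl⟩ := Submodule.Quotient.mk_surjective _ x
    rw [← Submodule.Quotient.mk_smul, Submodule.Quotient.mk_eq_zero]
    obtain ⟨w, hw⟩ := H z.1 z.2
    exact ⟨w, Subtype.ext hw⟩

theorem forall_smul_tor1_iff (s : R) {K F M N : Type u}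
    [AddCommGroup K] [Module R K] [AddCommGroup F] [Module R F] [AddCommGroup M] [Module R M]
    [AddCommGroup N] [Module R N] [Module.Flat R F] {f : K →ₗ[R] F} {g : F →ₗ[R] M}
    (hf : Function.Injective f) (hfg : Function.Exact f g) (hg : Function.Surjective g) :
    (∀ x : Tor1 R M N, s • x = 0) ↔ ∀ x : K ⊗[R] N, f.rTensor N x = 0 → s • x = 0 := by
  let P := projectiveResolution (ModuleCat.of R N)
  let T := (MonoidalCategory.tensoringLeft (ModuleCat.{u} R)).obj (ModuleCat.of R M)
  let C := (T.mapHomologicalComplex (ComplexShape.down ℕ)).obj P.complex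
  let e : Tor1 R M N ≃ₗ[R] (C.sc' 2 1 0).homology :=
    (P.isoLeftDerivedObj T 1 ≪≫ C.homologyIsoSc' 2 1 0 (by simp) (by simp)).toLinearEquiv
  have he : (∀ x : Tor1 R M N, s • x = 0) ↔ ∀ x : (C.sc' 2 1 0).homology, s • x = 0 :=
    ⟨fun H x ↦ e.symm.injective (by rw [map_smul, H, map_zero]),
      fun H x ↦ e.injective (by rw [map_smul, H, map_zero])⟩
  have : ∀ n, Module.Flat R (P.complex.X n) := fun n ↦ by
    have : Module.Projective R (P.complex.X n) :=
      (IsProjective.iff_projective (P.complex.X n)).2 (P.projective n)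
    infer_instance
  let d₁ : P.complex.X 1 →ₗ[R] P.complex.X 0 := (P.complex.d 1 0).hom
  let d₂ : P.complex.X 2 →ₗ[R] P.complex.X 1 := (P.complex.d 2 1).hom
  let k : P.complex.X 0 →ₗ[R] N := (P.π.f 0).hom
  have hk : Function.Surjective k := (ModuleCat.epi_iff_surjective _).1 inferInstance
  have hd : Function.Exact d₁ k :=
    (ShortComplex.ShortExact.moduleCat_exact_iff_function_exact _).1 P.exact₀
  have hd' : Function.Exact d₂ d₁ :=
    (ShortComplex.ShortExact.moduleCat_exact_iff_function_exact _).1 (P.exact_succ 0)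
  let ι := (LinearMap.range d₁).subtype
  have hι : Function.Exact ι k := by
    intro x
    rw [hd x]
    simp [ι]
  have hr : Function.Exact d₂ d₁.rangeRestrict := by
    intro x
    rw [← hd' x, Subtype.ext_iff]
    rfl
  rw [he, forall_smul_moduleCatHomology_iff,
    ← smul_eq_zero_on_ker_lTensor_iff s hf hfg hg Subtype.val_injective hι hk]
  change (∀ z : M ⊗[R] P.complex.X 1, d₁.lTensor M z = 0 →
    s • z ∈ LinearMap.range (d₂.lTensor M)) ↔ _
  have hcomp (z) : ι.lTensor M (d₁.rangeRestrict.lTensor M z) = d₁.lTensor M z := by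
    rw [← LinearMap.comp_apply, ← LinearMap.lTensor_comp]; rfl
  have hex := lTensor_exact M hr d₁.surjective_rangeRestrict
  constructor
  · intro H x hx
    obtain ⟨z, rfl⟩ := LinearMap.lTensor_surjective M d₁.surjective_rangeRestrict x
    rw [← map_smul]
    exact (hex _).2 (H z (by rw [← hcomp]; exact hx))
  · intro H z hz
    refine (hex _).1 ?_
    rw [map_smul]
    exact H _ (by rw [← hz, ← hcomp])

theorem isSFinite_submodule_iff (S : Submonoid R) {M : Type u} [AddCommGroup M] [Module R M]
    {L : Submodule R M} :
    IsSFinite S L ↔ ∃ s ∈ S, ∃ N ≤ L, N.FG ∧ ∀ x ∈ L, s • x ∈ N := by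
  constructor
  · rintro ⟨s, hs, K, hK, h⟩
    exact ⟨s, hs, K.map L.subtype, Submodule.map_subtype_le L K, hK.map _,
      fun x hx ↦ ⟨s • ⟨x, hx⟩, h ⟨x, hx⟩, rfl⟩⟩
  · rintro ⟨s, hs, N, hNL, hN, h⟩
    refine ⟨s, hs, N.comap L.subtype, ?_, fun x ↦ h x x.2⟩
    refine Submodule.fg_of_fg_map_injective L.subtype L.subtype_injective ?_
    rwa [Submodule.map_comap_subtype, inf_eq_right.2 hNL]

theorem IsSFinitelyPresented.isSFinite_ker {S : Submonoid R} {P M : Type u} [AddCommGroup P]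
    [Module R P] [AddCommGroup M] [Module R M] [Module.Finite R P] [Module.Projective R P]
    (hM : IsSFinitelyPresented S M) (φ : P →ₗ[R] M) (hφ : Function.Surjective φ) :
    IsSFinite S (LinearMap.ker φ) := by
  obtain ⟨n, π, hπ, hker⟩ := hM
  obtain ⟨s, hs, N, hN, hNfg, hsN⟩ := (isSFinite_submodule_iff S).1 hker
  obtain ⟨g, hg⟩ := Module.projective_lifting_property π φ hπ
  obtain ⟨h, hh⟩ := Module.projective_lifting_property φ π hφ
  have hg' (x) : π (g x) = φ x := LinearMap.congr_fun hg x
  have hh' (x) : φ (h x) = π x := LinearMap.congr_fun hh x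
  refine (isSFinite_submodule_iff S).2
    ⟨s, hs, LinearMap.range (LinearMap.id - h ∘ₗ g) ⊔ N.map h, sup_le ?_ ?_,
      (Submodule.fg_range _).sup (hNfg.map h), fun x hx ↦ ?_⟩
  · rintro _ ⟨x, rfl⟩
    simp [hg', hh']
  · rintro _ ⟨x, hx, rfl⟩
    rw [LinearMap.mem_ker, hh']
    exact hN hx
  · have hx' : s • x = (LinearMap.id - h ∘ₗ g : P →ₗ[R] P) (s • x) + h (s • g x) := by
      simp [smul_sub]
    rw [hx']
    refine Submodule.add_mem_sup ⟨_, rfl⟩ ⟨_, hsN _ ?_, rfl⟩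
    rw [LinearMap.mem_ker, hg']
    exact hx

theorem Submodule.FG.exists_fin_range_eq {M : Type*} [AddCommGroup M] [Module R M]
    {L : Submodule R M} (hL : L.FG) : ∃ (p : ℕ) (B : (Fin p → R) →ₗ[R] M),
      LinearMap.range B = L := by
  have := Module.Finite.iff_fg.2 hL
  obtain ⟨p, B, hB⟩ := Module.Finite.exists_fin' R L
  exact ⟨p, L.subtype ∘ₗ B, by
    rw [LinearMap.range_comp, LinearMap.range_eq_top.2 hB, Submodule.map_top,
      Submodule.range_subtype]⟩

theorem IsSCoherentRing.isSFinite_ker {S : Submonoid R} (hS : IsSCoherentRing S) {m n : ℕ}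
    (A : (Fin m → R) →ₗ[R] (Fin n → R)) : IsSFinite S (LinearMap.ker A) := by
  induction n with
  | zero =>
    exact (isSFinite_submodule_iff S).2 ⟨1, S.one_mem, ⊤, fun x _ ↦ Subsingleton.elim _ _,
      Module.Finite.fg_top, fun _ _ ↦ trivial⟩
  | succ n ih =>
    obtain ⟨s, hs, L, hL, hLfg, hsL⟩ :=
      (isSFinite_submodule_iff S).1 (ih (LinearMap.funLeft R R Fin.succ ∘ₗ A))
    obtain ⟨p, B, rfl⟩ := hLfg.exists_fin_range_eq
    let a : (Fin p → R) →ₗ[R] R := LinearMap.proj 0 ∘ₗ A ∘ₗ B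
    obtain ⟨t, ht, N, hN, hNfg, htN⟩ := (isSFinite_submodule_iff S).1
      ((hS (LinearMap.range a) (Submodule.fg_range a)).isSFinite_ker _ a.surjective_rangeRestrict)
    rw [LinearMap.ker_rangeRestrict] at hN htN
    refine (isSFinite_submodule_iff S).2
      ⟨t * s, S.mul_mem ht hs, N.map B, ?_, hNfg.map B, fun x hx ↦ ?_⟩
    · rintro _ ⟨y, hy, rfl⟩
      refine funext (Fin.cases (hN hy) fun i ↦ ?_)
      exact congrFun (hL ⟨y, rfl⟩) i
    · obtain ⟨y, hy⟩ := hsL x (by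
        rw [LinearMap.mem_ker, LinearMap.comp_apply, LinearMap.mem_ker.1 hx, map_zero])
      refine ⟨t • y, htN y ?_, by rw [map_smul, hy, mul_smul]⟩
      simp [a, hy, LinearMap.mem_ker.1 hx]

theorem exists_rTensor_eq_smul {s : R} {P Q V N : Type*} [AddCommGroup P] [Module R P]
    [AddCommGroup Q] [Module R Q] [AddCommGroup V] [Module R V] [AddCommGroup N] [Module R N]
    [Module.Flat R N] {B : P →ₗ[R] Q} {A : Q →ₗ[R] V}
    (h : ∀ x ∈ LinearMap.ker A, s • x ∈ LinearMap.range B) {x : Q ⊗[R] N}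
    (hx : A.rTensor N x = 0) : ∃ z, B.rTensor N z = s • x := by
  obtain ⟨y, rfl⟩ := (Module.Flat.rTensor_exact N A.exact_subtype_ker_map x).1 hx
  let σ : LinearMap.ker A →ₗ[R] LinearMap.range B :=
    (s • (LinearMap.ker A).subtype).codRestrict _ fun x ↦ h x x.2
  obtain ⟨z, hz⟩ := LinearMap.rTensor_surjective N B.surjective_rangeRestrict (σ.rTensor N y)
  refine ⟨z, ?_⟩
  have h₁ : B = (LinearMap.range B).subtype ∘ₗ B.rangeRestrict := rfl
  have h₂ : (LinearMap.range B).subtype ∘ₗ σ = s • (LinearMap.ker A).subtype := rfl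
  rw [h₁, LinearMap.rTensor_comp, LinearMap.comp_apply, hz, ← LinearMap.comp_apply,
    ← LinearMap.rTensor_comp, h₂, LinearMap.rTensor_smul, LinearMap.smul_apply]

theorem equivFinsuppOfBasisLeft_lTensor {κ V N N' : Type*} [DecidableEq κ] [AddCommGroup V]
    [Module R V] [AddCommGroup N] [Module R N] [AddCommGroup N'] [Module R N']
    (b : Module.Basis κ R V) (f : N →ₗ[R] N') (x : V ⊗[R] N) (j : κ) :
    TensorProduct.equivFinsuppOfBasisLeft b (f.lTensor V x) j =
      f (TensorProduct.equivFinsuppOfBasisLeft b x j) := by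
  induction x with
  | zero => simp
  | tmul v n => simp
  | add x y hx hy => simp [hx, hy]

theorem eq_of_lTensor_proj_eq {κ ι V : Type*} [DecidableEq κ]
    [AddCommGroup V] [Module R V] (b : Module.Basis κ R V) {N : ι → Type*}
    [∀ i, AddCommGroup (N i)] [∀ i, Module R (N i)]
    {x y : V ⊗[R] (∀ i, N i)}
    (h : ∀ i, (LinearMap.proj i).lTensor V x = (LinearMap.proj i : _ →ₗ[R] N i).lTensor V y) :
    x = y := by
  apply (TensorProduct.equivFinsuppOfBasisLeft b).injective
  ext j i
  simpa [equivFinsuppOfBasisLeft_lTensor] using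
    congrArg (fun z ↦ TensorProduct.equivFinsuppOfBasisLeft b z j) (h i)

theorem exists_lTensor_proj_eq {κ ι V : Type*} [DecidableEq κ] [Finite κ]
    [AddCommGroup V] [Module R V] (b : Module.Basis κ R V) {N : ι → Type*}
    [∀ i, AddCommGroup (N i)] [∀ i, Module R (N i)]
    (z : ∀ i, V ⊗[R] N i) :
    ∃ x : V ⊗[R] (∀ i, N i), ∀ i, (LinearMap.proj i).lTensor V x = z i := by
  refine ⟨(TensorProduct.equivFinsuppOfBasisLeft b).symm (Finsupp.equivFunOnFinite.symm
    fun j i ↦ TensorProduct.equivFinsuppOfBasisLeft b (z i) j), fun i ↦ ?_⟩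
  apply (TensorProduct.equivFinsuppOfBasisLeft b).injective
  ext j
  rw [equivFinsuppOfBasisLeft_lTensor, LinearEquiv.apply_symm_apply]
  rfl

theorem IsSCoherentRing.isSFlat_pi {S : Submonoid R} (hS : IsSCoherentRing S) {ι : Type u}
    (N : ι → Type u) [∀ i, AddCommGroup (N i)] [∀ i, Module R (N i)]
    [∀ i, Module.Flat R (N i)] : IsSFlat S (∀ i, N i) := by
  intro M _ _ _
  obtain ⟨n, g, hg⟩ := Module.Finite.exists_fin' R M
  obtain ⟨m, A, hA⟩ := (Module.FinitePresentation.fg_ker g hg).exists_fin_range_eq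
  obtain ⟨s, hs, L, hL, hLfg, hsL⟩ := (isSFinite_submodule_iff S).1 (hS.isSFinite_ker A)
  obtain ⟨p, B, rfl⟩ := hLfg.exists_fin_range_eq
  refine ⟨s, hs, (forall_smul_tor1_iff s (LinearMap.range A).subtype_injective
    (by rw [hA]; exact g.exact_subtype_ker_map) hg).2 fun x hx ↦ ?_⟩
  obtain ⟨y, rfl⟩ := LinearMap.rTensor_surjective (∀ i, N i) A.surjective_rangeRestrict x
  have hy : A.rTensor (∀ i, N i) y = 0 := by
    rw [← hx, ← LinearMap.comp_apply, ← LinearMap.rTensor_comp]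
    rfl
  have hcomm {a c : ℕ} (C : (Fin a → R) →ₗ[R] (Fin c → R)) (i : ι) (w) :
      (LinearMap.proj i : _ →ₗ[R] N i).lTensor _ (C.rTensor (∀ i, N i) w) =
        C.rTensor (N i) ((LinearMap.proj i).lTensor _ w) := by
    rw [← LinearMap.comp_apply, ← LinearMap.comp_apply, LinearMap.lTensor_comp_rTensor,
      LinearMap.rTensor_comp_lTensor]
  have hz (i) : ∃ z, B.rTensor (N i) z = s • (LinearMap.proj i).lTensor _ y :=
    exists_rTensor_eq_smul hsL (by rw [← hcomm, hy, map_zero])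
  choose z hz using hz
  obtain ⟨w, hw⟩ := exists_lTensor_proj_eq (Pi.basisFun R (Fin p)) z
  have hwy : B.rTensor _ w = s • y :=
    eq_of_lTensor_proj_eq (Pi.basisFun R (Fin m)) fun i ↦ by rw [hcomm, hw, hz, map_smul]
  have hAB : A.rangeRestrict ∘ₗ B = 0 :=
    LinearMap.ext fun v ↦ Subtype.ext (hL ⟨v, rfl⟩)
  rw [← map_smul, ← hwy, ← LinearMap.comp_apply, ← LinearMap.rTensor_comp, hAB,
    LinearMap.rTensor_zero, LinearMap.zero_apply]

theorem exists_fg_forall_piScalarRightHom_mem {M ι : Type*} [AddCommGroup M] [Module R M]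
    (w : M ⊗[R] (ι → R)) :
    ∃ N : Submodule R M, N.FG ∧ ∀ i, TensorProduct.piScalarRightHom R R M ι w i ∈ N := by
  induction w with
  | zero => exact ⟨⊥, Submodule.fg_bot, by simp⟩
  | tmul x f =>
    exact ⟨R ∙ x, Submodule.fg_span_singleton x, fun i ↦ by
      simpa using Submodule.smul_mem _ _ (Submodule.mem_span_singleton_self x)⟩
  | add x y hx hy =>
    obtain ⟨N, hN, h⟩ := hx
    obtain ⟨N', hN', h'⟩ := hy
    exact ⟨N ⊔ N', hN.sup hN', fun i ↦ by
      rw [map_add]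
      exact Submodule.add_mem_sup (h i) (h' i)⟩

theorem piScalarRightHom_rTensor {M M' ι : Type*} [AddCommGroup M] [Module R M]
    [AddCommGroup M'] [Module R M'] (f : M →ₗ[R] M') (w : M ⊗[R] (ι → R)) (i : ι) :
    TensorProduct.piScalarRightHom R R M' ι (f.rTensor _ w) i =
      f (TensorProduct.piScalarRightHom R R M ι w i) := by
  induction w with
  | zero => simp
  | tmul x g => simp
  | add x y hx hy => simp [hx, hy]

theorem isSCoherentRing_of_isSFlat_pi {S : Submonoid R}
    (H : ∀ ι : Type u, IsSFlat S (ι → R)) : IsSCoherentRing S := by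
  intro I hI
  have : Module.Finite R I := Module.Finite.iff_fg.2 hI
  obtain ⟨n, π, hπ⟩ := Module.Finite.exists_fin' R I
  refine ⟨n, π, hπ, ?_⟩
  let K := LinearMap.ker π
  have : Module.FinitePresentation R (R ⧸ I) :=
    Module.finitePresentation_of_surjective I.mkQ I.mkQ_surjective (by rwa [Submodule.ker_mkQ])
  obtain ⟨s, hs, h⟩ := H K (R ⧸ I) this
  rw [forall_smul_tor1_iff s I.subtype_injective (LinearMap.exact_subtype_mkQ I)
    I.mkQ_surjective] at h
  let x : (Fin n → R) ⊗[R] (K → R) := ∑ j, Pi.single j 1 ⊗ₜ fun k ↦ k.1 j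
  have hx (k : K) : TensorProduct.piScalarRightHom R R _ K x k = k := by
    simp only [x, map_sum, Finset.sum_apply, TensorProduct.piScalarRightHom_tmul]
    exact (pi_eq_sum_univ' k.1).symm
  have hsx : π.rTensor _ (s • x) = 0 := by
    rw [map_smul]
    refine h _ ((TensorProduct.lid R (K → R)).injective ?_)
    have hlid (w : R ⊗[R] (K → R)) :
        TensorProduct.lid R (K → R) w = TensorProduct.piScalarRightHom R R R K w := by
      induction w with
      | zero => simp
      | tmul a f => ext; simp [mul_comm]
      | add x y hx hy => simp [hx, hy]
    rw [map_zero, hlid]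
    ext k
    rw [piScalarRightHom_rTensor, piScalarRightHom_rTensor, hx, LinearMap.mem_ker.1 k.2]
    rfl
  obtain ⟨w, hw⟩ := (rTensor_exact (K → R) π.exact_subtype_ker_map hπ _).1 hsx
  obtain ⟨N, hN, hwN⟩ := exists_fg_forall_piScalarRightHom_mem w
  refine ⟨s, hs, N, hN, fun k ↦ ?_⟩
  convert hwN k
  apply Subtype.ext
  have := congrArg (fun w ↦ TensorProduct.piScalarRightHom R R _ K w k) hw
  simp only [piScalarRightHom_rTensor, map_smul, Pi.smul_apply, hx] at this
  exact this.symm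

/-- Theorem 4.2 (new S-version of Chase's Theorem): `R` is `S`-coherent iff products
of flat modules are s-flat, iff products of projective modules are s-flat, iff
products of copies of `R` are s-flat. -/
theorem isSCoherent_tfae_sFlat (R : Type u) [CommRing R] (S : Submonoid R) :
    List.TFAE
      [ IsSCoherentRing S,
        ∀ (ι : Type u) (M : ι → Type u) [∀ i, AddCommGroup (M i)] [∀ i, Module R (M i)],
          (∀ i, Module.Flat R (M i)) → IsSFlat S (∀ i, M i),
        ∀ (ι : Type u) (M : ι → Type u) [∀ i, AddCommGroup (M i)] [∀ i, Module R (M i)],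
          (∀ i, Module.Projective R (M i)) → IsSFlat S (∀ i, M i),
        ∀ ι : Type u, IsSFlat S (ι → R) ] := by
  tfae_have 1 → 2 := fun hS _ M _ _ _ ↦ hS.isSFlat_pi M
  tfae_have 2 → 3 := fun H ι M _ _ _ ↦ H ι M fun _ ↦ inferInstance
  tfae_have 3 → 4 := fun H ι ↦ H ι (fun _ ↦ R) fun _ ↦ inferInstance
  tfae_have 4 → 1 := isSCoherentRing_of_isSFlat_pi
  tfae_finish
end
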